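/- arXiv:1604.00527 — 5 statements merged into one kernel-verified Lean document; each statement's English description precedes it below -/
import Mathlib

section
/- Let τ : Fin m → Ω (m ≥ 1) be a route for crane k, let D : Ω → ℝ be completion times feasible along τ for crane k, and let the crane completion time C ∈ ℝ satisfy C ≥ D(τ (m−1)) + t·|l(τ (m−1)) − lT(k)|. Then C ≥ r(k) + t·|l0(k) − l(τ 0)| + t·(Σ_{u+1 < m} |l(τ u) − l(τ (u+1))|) + t·|l(τ (m−1)) − lT(k)| + Σ_{u < m} p(τ u). Consequently, the makespan of any feasible schedule (the maximum of the crane completion times) is at least the maximum over the cranes of the total travel-plus-processing cost of the route that the schedule induces on that crane; i.e., the optimal value of the routing sub-problem, which minimizes the longest such route cost while ignoring crane interference, is a lower bound for the optimal makespan of the quay crane scheduling problem. -/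
/-- If each term of `d` exceeds the previous one by at least `c i + q i.succ`, then the last term
is at least the total of all these increments above the starting value. -/
theorem add_sum_add_sum_le_last {n : ℕ} (d q : Fin (n + 1) → ℝ) (c : Fin n → ℝ) (a : ℝ)
    (hfirst : a + q 0 ≤ d 0)
    (hstep : ∀ i : Fin n, d i.castSucc + c i + q i.succ ≤ d i.succ) :
    a + ∑ i, c i + ∑ i, q i ≤ d (Fin.last n) := by
  induction n with
  | zero => simpa using hfirst
  | succ n ih =>
    have hprev := ih (fun i => d i.castSucc) (fun i => q i.castSucc) (fun i => c i.castSucc)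
      hfirst (fun i => hstep i.castSucc)
    have hlast := hstep (Fin.last n)
    rw [Fin.sum_univ_castSucc, Fin.sum_univ_castSucc (n := n + 1)]
    rw [Fin.succ_last] at hlast
    linarith


/-- The total travel-plus-processing cost of a crane's route is a lower bound for
the crane's completion time: if `D` is feasible along the route `τ` for a crane
with ready time `rk`, initial bay `l0` and final bay `lT`, and
`C ≥ D (τ (m−1)) + t·|l (τ (m−1)) − lT|`, then
`C ≥ rk + t·|l0 − l (τ 0)| + t·Σ_{u+1<m} |l (τ u) − l (τ (u+1))| + t·|l (τ (m−1)) − lT| + Σ_{u<m} p (τ u)`.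
Hence the optimal value of the routing sub-problem (minimizing the longest such
route cost, ignoring crane interference) is a lower bound for the makespan. -/
theorem route_cost_lower_bounds_completion {Ω : Type*} (m : ℕ) (hm : 1 ≤ m)
    (τ : Fin m → Ω) (hτ : Function.Injective τ)
    (l : Ω → ℤ) (p : Ω → ℝ) (hp : ∀ x, 0 ≤ p x)
    (t : ℝ) (ht : 0 ≤ t)
    (rk : ℝ) (hrk : 0 ≤ rk) (l0 lT : ℤ)
    (D : Ω → ℝ)
    (hfirst : D (τ ⟨0, by omega⟩) ≥
      rk + t * |((l0 : ℝ)) - (l (τ ⟨0, by omega⟩) : ℝ)| + p (τ ⟨0, by omega⟩))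
    (hstep : ∀ s : ℕ, (h : s + 1 < m) →
      D (τ ⟨s + 1, h⟩) ≥ D (τ ⟨s, by omega⟩) +
        t * |(l (τ ⟨s, by omega⟩) : ℝ) - (l (τ ⟨s + 1, h⟩) : ℝ)| +
        p (τ ⟨s + 1, h⟩))
    (C : ℝ)
    (hC : C ≥ D (τ ⟨m - 1, by omega⟩) +
      t * |(l (τ ⟨m - 1, by omega⟩) : ℝ) - (lT : ℝ)|) :
    C ≥ rk + t * |((l0 : ℝ)) - (l (τ ⟨0, by omega⟩) : ℝ)| +
      t * (∑ u : Fin (m - 1), |(l (τ ⟨u, by have := u.isLt; omega⟩) : ℝ) -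
        (l (τ ⟨u + 1, by have := u.isLt; omega⟩) : ℝ)|) +
      t * |(l (τ ⟨m - 1, by omega⟩) : ℝ) - (lT : ℝ)| +
      ∑ u : Fin m, p (τ u) := by
  obtain ⟨n, rfl⟩ := Nat.exists_eq_add_of_le' hm
  have hlast := add_sum_add_sum_le_last (n := n + 1 - 1) (fun i => D (τ i)) (fun i => p (τ i))
    (fun i => t * |(l (τ i.castSucc) : ℝ) - (l (τ i.succ) : ℝ)|) _ hfirst
    (fun i => hstep i (Nat.succ_lt_succ i.isLt))
  rw [← Finset.mul_sum] at hlast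
  exact le_trans (by rw [add_right_comm]; exact add_le_add_left hlast _) hC
end

section
/- Let v : Fin (m+1) → V be an injective sequence of vertices of a finite type V (a simple directed path v 0 → v 1 → ⋯ → v m), let i and j be vertices appearing on the path at positions a and b respectively with a < b (i is visited before j), and let S be a finite set of vertices with v 0 ∈ S, j ∈ S and i ∉ S. Then the number of consecutive pairs lying inside S, namely the cardinality of { s : s < m, v s ∈ S and v (s+1) ∈ S }, is at most |S| − 2. (This is the lifted subtour elimination inequality x^k(S) ≤ |S| − 2 valid for any crane route that starts at the initial depot 0 ∈ S and must perform task i before task j when i ≺ j.) -/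
/-- A sequence that is outside `S` at position `a` and inside `S` at a later position `b` enters `S`
along some arc. -/
theorem exists_castSucc_notMem_succ_mem {V : Type*} {m : ℕ} (v : Fin (m + 1) → V)
    {a b : Fin (m + 1)} (hab : a ≤ b) {S : Finset V} (ha : v a ∉ S) (hb : v b ∈ S) :
    ∃ c : Fin m, v c.castSucc ∉ S ∧ v c.succ ∈ S := by
  by_contra! h
  have key : ∀ n : ℕ, (a : ℕ) ≤ n → ∀ hn : n < m + 1, v ⟨n, hn⟩ ∉ S := by
    intro n han
    induction n, han using Nat.le_induction with
    | base => exact fun _ => ha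
    | succ n _ ih => exact fun hn => h ⟨n, by omega⟩ (ih (by omega))
  exact key b hab b.isLt hb

/-- Lifted subtour elimination inequality. Let `v : Fin (m+1) → V` be a simple
directed path in a finite type `V`, let `i = v a` and `j = v b` with `a < b`
(so `i` is visited before `j`), and let `S` be a set of vertices with
`v 0 ∈ S`, `j ∈ S` and `i ∉ S`. Then the number of arcs of the path with both
endpoints in `S` is at most `|S| − 2`. -/
theorem lifted_subtour_elimination {V : Type*} [Fintype V] [DecidableEq V]
    (m : ℕ) (v : Fin (m + 1) → V) (hv : Function.Injective v)
    (a b : Fin (m + 1)) (hab : a < b) (i j : V)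
    (hi : v a = i) (hj : v b = j)
    (S : Finset V) (h0 : v ⟨0, by omega⟩ ∈ S) (hjS : j ∈ S) (hiS : i ∉ S) :
    (Finset.univ.filter
      (fun s : Fin m => v s.castSucc ∈ S ∧ v s.succ ∈ S)).card ≤ S.card - 2 := by
  subst hi hj
  obtain ⟨c, hc, hcS⟩ := exists_castSucc_notMem_succ_mem v hab.le hiS hjS
  have hc0 : v c.succ ≠ v ⟨0, by omega⟩ := fun h => Fin.succ_ne_zero c (hv h)
  have hcard : ((S.erase (v ⟨0, by omega⟩)).erase (v c.succ)).card = S.card - 2 := by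
    rw [Finset.card_erase_of_mem (Finset.mem_erase.2 ⟨hc0, hcS⟩), Finset.card_erase_of_mem h0]
    omega
  rw [← hcard]
  refine Finset.card_le_card_of_injOn (fun s => v s.succ) (fun s hs => ?_)
    (hv.comp (Fin.succ_injective m)).injOn
  obtain ⟨hs₁, hs₂⟩ := (Finset.mem_filter.1 hs).2
  refine Finset.mem_erase.2 ⟨fun h => ?_, Finset.mem_erase.2 ⟨fun h => ?_, hs₂⟩⟩
  · obtain rfl := Fin.succ_injective m (hv h)
    exact hc hs₁
  · exact Fin.succ_ne_zero s (hv h)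
end

section
/- Let (i, j) be a precedence pair (i ≺ j). Let τ : Fin m → Ω be a route for crane v with τ a = i for some position a < m, and let σ : Fin m' → Ω be a route for crane w (m' ≥ 1) with σ c = j for some position c < m'. Let D : Ω → ℝ be completion times feasible along τ for crane v and feasible along σ for crane w, satisfying the precedence D(i) ≤ D(j) − p(j), and let C ∈ ℝ satisfy C ≥ D(σ (m'−1)) + t·|l(σ (m'−1)) − lT(w)|. Then C ≥ s_i + p(j) + s_j, where s_i = r(v) + t·|l0(v) − l(τ 0)| + t·(Σ_{u < a} |l(τ u) − l(τ (u+1))|) + Σ_{u ≤ a} p(τ u) is the travel-plus-processing cost of crane v's route prefix up to and including i, and s_j = t·(Σ_{c ≤ u, u+1 < m'} |l(σ u) − l(σ (u+1))|) + Σ_{c < u < m'} p(σ u) + t·|l(σ (m'−1)) − lT(w)| is the travel-plus-processing cost of crane w's route strictly after j up to its final position. Hence any routing whose prefix cost to i plus p(j) plus suffix cost after j exceeds the best known makespan UB* cannot yield a schedule with makespan at most UB*. -/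
/-- Along a route on which every step takes at least travel plus processing time, the completion
time `k` positions after position `c` is at least the completion time at `c` plus the accumulated
travel and processing times in between. -/
theorem completion_add_route_cost_le {Ω : Type*} (l : Ω → ℤ) (p : Ω → ℝ) (t : ℝ) {n : ℕ}
    (ρ : Fin n → Ω) (D : Ω → ℝ)
    (hstep : ∀ s : ℕ, (h : s + 1 < n) →
      D (ρ ⟨s + 1, h⟩) ≥ D (ρ ⟨s, by omega⟩) +
        t * |(l (ρ ⟨s, by omega⟩) : ℝ) - (l (ρ ⟨s + 1, h⟩) : ℝ)| + p (ρ ⟨s + 1, h⟩))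
    (c k : ℕ) (h : c + k < n) :
    D (ρ ⟨c, by omega⟩) +
        t * (∑ u : Fin k, |(l (ρ ⟨c + u, by have := u.isLt; omega⟩) : ℝ) -
          (l (ρ ⟨c + u + 1, by have := u.isLt; omega⟩) : ℝ)|) +
        ∑ u : Fin k, p (ρ ⟨c + 1 + u, by have := u.isLt; omega⟩) ≤
      D (ρ ⟨c + k, h⟩) := by
  induction k with
  | zero => simp
  | succ k ih =>
    have hprev := ih (by omega)
    have hlast := hstep (c + k) (by omega)
    simp only [Fin.sum_univ_castSucc, Fin.val_castSucc, Fin.val_last, mul_add,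
      add_right_comm c 1, ← add_assoc] at hprev ⊢
    linarith


/-- Combinatorial cut from a precedence split over two cranes. Suppose `i ≺ j`,
crane `v` performs `i` at position `a` of its route `τ`, crane `w` performs `j`
at position `c` of its route `σ`, completion times `D` are feasible along both
routes and respect the precedence `D i ≤ D j − p j`, and
`C ≥ D (σ (m'−1)) + t·|l (σ (m'−1)) − lT(w)|`. Then `C ≥ s_i + p j + s_j`,
where `s_i` is the travel-plus-processing cost of crane `v`'s route prefix up
to and including `i`, and `s_j` is the travel-plus-processing cost of crane
`w`'s route strictly after `j` up to its final position. Hence a routing with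
`s_i + p j + s_j > UB*` cannot yield a schedule with makespan at most `UB*`. -/
theorem precedence_split_cut {Ω : Type*}
    (l : Ω → ℤ) (p : Ω → ℝ) (hp : ∀ x, 0 ≤ p x) (t : ℝ) (ht : 0 ≤ t)
    -- crane v data and route τ
    (rv : ℝ) (hrv : 0 ≤ rv) (l0v : ℤ)
    (m : ℕ) (hm : 1 ≤ m) (τ : Fin m → Ω) (hτ : Function.Injective τ)
    -- crane w data and route σ
    (rw : ℝ) (hrw : 0 ≤ rw) (l0w lTw : ℤ)
    (m' : ℕ) (hm' : 1 ≤ m') (σ : Fin m' → Ω) (hσ : Function.Injective σ)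
    -- the precedence pair (i, j): i at position a on τ, j at position c on σ
    (i j : Ω) (a : ℕ) (ha : a < m) (hia : τ ⟨a, ha⟩ = i)
    (c : ℕ) (hc : c < m') (hjc : σ ⟨c, hc⟩ = j)
    (D : Ω → ℝ)
    -- D feasible along τ for crane v
    (hτfirst : D (τ ⟨0, by omega⟩) ≥
      rv + t * |((l0v : ℝ)) - (l (τ ⟨0, by omega⟩) : ℝ)| + p (τ ⟨0, by omega⟩))
    (hτstep : ∀ s : ℕ, (h : s + 1 < m) →
      D (τ ⟨s + 1, h⟩) ≥ D (τ ⟨s, by omega⟩) +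
        t * |(l (τ ⟨s, by omega⟩) : ℝ) - (l (τ ⟨s + 1, h⟩) : ℝ)| +
        p (τ ⟨s + 1, h⟩))
    -- D feasible along σ for crane w
    (hσfirst : D (σ ⟨0, by omega⟩) ≥
      rw + t * |((l0w : ℝ)) - (l (σ ⟨0, by omega⟩) : ℝ)| + p (σ ⟨0, by omega⟩))
    (hσstep : ∀ s : ℕ, (h : s + 1 < m') →
      D (σ ⟨s + 1, h⟩) ≥ D (σ ⟨s, by omega⟩) +
        t * |(l (σ ⟨s, by omega⟩) : ℝ) - (l (σ ⟨s + 1, h⟩) : ℝ)| +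
        p (σ ⟨s + 1, h⟩))
    -- the precedence i ≺ j
    (hprec : D i ≤ D j - p j)
    -- C bounds crane w's completion time
    (C : ℝ)
    (hC : C ≥ D (σ ⟨m' - 1, by omega⟩) +
      t * |(l (σ ⟨m' - 1, by omega⟩) : ℝ) - (lTw : ℝ)|) :
    C ≥
      -- s_i : prefix cost of crane v up to and including i
      (rv + t * |((l0v : ℝ)) - (l (τ ⟨0, by omega⟩) : ℝ)| +
        t * (∑ u : Fin a, |(l (τ ⟨u, by have := u.isLt; omega⟩) : ℝ) -
          (l (τ ⟨u + 1, by have := u.isLt; omega⟩) : ℝ)|) +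
        ∑ u : Fin (a + 1), p (τ ⟨u, by have := u.isLt; omega⟩))
      + p j +
      -- s_j : suffix cost of crane w strictly after j up to its final position
      (t * (∑ u : Fin (m' - 1 - c), |(l (σ ⟨c + u, by have := u.isLt; omega⟩) : ℝ) -
          (l (σ ⟨c + u + 1, by have := u.isLt; omega⟩) : ℝ)|) +
        (∑ u : Fin (m' - 1 - c), p (σ ⟨c + 1 + u, by have := u.isLt; omega⟩)) +
        t * |(l (σ ⟨m' - 1, by omega⟩) : ℝ) - (lTw : ℝ)|) := by
  subst hia hjc
  have hprefix := completion_add_route_cost_le l p t τ D hτstep 0 a (by omega)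
  have hsuffix := completion_add_route_cost_le l p t σ D hσstep c (m' - 1 - c) (by omega)
  have hlast : c + (m' - 1 - c) = m' - 1 := by omega
  simp only [hlast] at hsuffix
  simp only [zero_add, add_comm 1] at hprefix
  rw [Fin.sum_univ_succ (n := a)]
  simp only [Fin.val_zero, Fin.val_succ]
  linarith
end

section
/- Let (i, j) be a precedence pair (i ≺ j). Let τ : Fin m → Ω be a route for crane v with τ a = i, and let S_i = { τ u : u < a } be the set of tasks crane v performs before i. Let σ : Fin m' → Ω be a route for crane w with σ c = j, and let S_j = { σ u : c < u < m' } be the set of tasks crane w performs after j. Let D : Ω → ℝ be completion times feasible along τ for crane v and along σ for crane w with D(i) ≤ D(j) − p(j), and let C ∈ ℝ satisfy C ≥ D(σ (m'−1)) + t·|l(σ (m'−1)) − lT(w)|. Then C ≥ r(v) + Σ_{u ∈ S_i} p(u) + p(i) + p(j) + Σ_{u ∈ S_j} p(u). Hence, regardless of the order in which the tasks of S_i and of S_j are processed, if r(v) plus the total processing time of S_i ∪ {i} ∪ {j} ∪ S_j exceeds the best known makespan UB*, every routing in which crane v performs the tasks of S_i before i and crane w performs the tasks of S_j after j is sub-optimal.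 -/
open Finset in
/-- Completion times along a chain grow at least by the processing times passed. -/
lemma add_sum_Ioc_le_of_forall_step {n : ℕ} {E q : Fin n → ℝ}
    (hstep : ∀ s : ℕ, (h : s + 1 < n) → E ⟨s, by omega⟩ + q ⟨s + 1, h⟩ ≤ E ⟨s + 1, h⟩)
    {b d : ℕ} (hbd : b ≤ d) (hd : d < n) :
    E ⟨b, by omega⟩ + ∑ u ∈ Ioc (⟨b, by omega⟩ : Fin n) ⟨d, hd⟩, q u ≤ E ⟨d, hd⟩ := by
  induction d, hbd using Nat.le_induction with
  | base => simp
  | succ d hbd ih =>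
    have hinsert : Ioc (⟨b, by omega⟩ : Fin n) ⟨d + 1, hd⟩ =
        insert ⟨d + 1, hd⟩ (Ioc (⟨b, by omega⟩ : Fin n) ⟨d, by omega⟩) := by
      ext u
      simp only [mem_Ioc, mem_insert, Fin.lt_def, Fin.le_def, Fin.ext_iff]
      omega
    rw [hinsert, sum_insert (by simp [Fin.le_def])]
    linarith [ih (by omega), hstep d hd]

/-- Set-strengthened combinatorial cut. Suppose `i ≺ j`, crane `v` performs the
tasks of `S_i = {τ u : u < a}` before `i = τ a`, crane `w` performs the tasks
of `S_j = {σ u : c < u < m'}` after `j = σ c`, the completion times `D` are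
feasible along both routes and respect `D i ≤ D j − p j`, and
`C ≥ D (σ (m'−1)) + t·|l (σ (m'−1)) − lT(w)|`. Then
`C ≥ r(v) + Σ_{u ∈ S_i} p u + p i + p j + Σ_{u ∈ S_j} p u`, regardless of the
order in which the tasks of `S_i` and `S_j` are processed. -/
theorem precedence_split_set_cut {Ω : Type*} [DecidableEq Ω]
    (l : Ω → ℤ) (p : Ω → ℝ) (hp : ∀ x, 0 ≤ p x) (t : ℝ) (ht : 0 ≤ t)
    -- crane v data and route τ
    (rv : ℝ) (hrv : 0 ≤ rv) (l0v : ℤ)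
    (m : ℕ) (hm : 1 ≤ m) (τ : Fin m → Ω) (hτ : Function.Injective τ)
    -- crane w data and route σ
    (rw : ℝ) (hrw : 0 ≤ rw) (l0w lTw : ℤ)
    (m' : ℕ) (hm' : 1 ≤ m') (σ : Fin m' → Ω) (hσ : Function.Injective σ)
    -- the precedence pair (i, j): i at position a on τ, j at position c on σ
    (i j : Ω) (a : ℕ) (ha : a < m) (hia : τ ⟨a, ha⟩ = i)
    (c : ℕ) (hc : c < m') (hjc : σ ⟨c, hc⟩ = j)
    (D : Ω → ℝ)
    -- D feasible along τ for crane v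
    (hτfirst : D (τ ⟨0, by omega⟩) ≥
      rv + t * |((l0v : ℝ)) - (l (τ ⟨0, by omega⟩) : ℝ)| + p (τ ⟨0, by omega⟩))
    (hτstep : ∀ s : ℕ, (h : s + 1 < m) →
      D (τ ⟨s + 1, h⟩) ≥ D (τ ⟨s, by omega⟩) +
        t * |(l (τ ⟨s, by omega⟩) : ℝ) - (l (τ ⟨s + 1, h⟩) : ℝ)| +
        p (τ ⟨s + 1, h⟩))
    -- D feasible along σ for crane w
    (hσfirst : D (σ ⟨0, by omega⟩) ≥
      rw + t * |((l0w : ℝ)) - (l (σ ⟨0, by omega⟩) : ℝ)| + p (σ ⟨0, by omega⟩))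
    (hσstep : ∀ s : ℕ, (h : s + 1 < m') →
      D (σ ⟨s + 1, h⟩) ≥ D (σ ⟨s, by omega⟩) +
        t * |(l (σ ⟨s, by omega⟩) : ℝ) - (l (σ ⟨s + 1, h⟩) : ℝ)| +
        p (σ ⟨s + 1, h⟩))
    -- the precedence i ≺ j
    (hprec : D i ≤ D j - p j)
    -- C bounds crane w's completion time
    (C : ℝ)
    (hC : C ≥ D (σ ⟨m' - 1, by omega⟩) +
      t * |(l (σ ⟨m' - 1, by omega⟩) : ℝ) - (lTw : ℝ)|) :
    C ≥ rv +
      (∑ x ∈ (Finset.univ.filter (fun u : Fin m => (u : ℕ) < a)).image τ, p x) +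
      p i + p j +
      ∑ x ∈ (Finset.univ.filter (fun u : Fin m' => c < (u : ℕ))).image σ, p x := by
  have travel_nonneg (x y : ℝ) : 0 ≤ t * |x - y| := mul_nonneg ht (abs_nonneg _)
  have hbefore := add_sum_Ioc_le_of_forall_step (E := D ∘ τ) (q := p ∘ τ)
    (fun s h => by
      simp only [Function.comp_apply]
      linarith [hτstep s h, travel_nonneg (l (τ ⟨s, by omega⟩)) (l (τ ⟨s + 1, h⟩))])
    (Nat.zero_le a) ha
  have hafter := add_sum_Ioc_le_of_forall_step (E := D ∘ σ) (q := p ∘ σ)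
    (fun s h => by
      simp only [Function.comp_apply]
      linarith [hσstep s h, travel_nonneg (l (σ ⟨s, by omega⟩)) (l (σ ⟨s + 1, h⟩))])
    (show c ≤ m' - 1 by omega) (by omega)
  have hτset : insert ⟨a, ha⟩ (Finset.univ.filter fun u : Fin m => (u : ℕ) < a) =
      insert ⟨0, by omega⟩ (Finset.Ioc (⟨0, by omega⟩ : Fin m) ⟨a, ha⟩) := by
    ext u
    simp only [Finset.mem_insert, Finset.mem_filter_univ, Finset.mem_Ioc, Fin.lt_def,
      Fin.le_def, Fin.ext_iff]
    omega
  have hτsum := congrArg (fun s => ∑ u ∈ s, p (τ u)) hτset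
  simp only at hτsum
  rw [Finset.sum_insert (by simp), Finset.sum_insert (by simp)] at hτsum
  have hσset : (Finset.univ.filter fun u : Fin m' => c < (u : ℕ)) =
      Finset.Ioc (⟨c, hc⟩ : Fin m') ⟨m' - 1, by omega⟩ := by
    ext u
    simp only [Finset.mem_filter_univ, Finset.mem_Ioc, Fin.lt_def, Fin.le_def]
    omega
  rw [Finset.sum_image hτ.injOn, Finset.sum_image hσ.injOn, hσset]
  simp only [Function.comp_apply, hia, hjc] at hbefore hafter hτsum
  linarith [travel_nonneg l0v (l (τ ⟨0, by omega⟩)),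
    travel_nonneg (l (σ ⟨m' - 1, by omega⟩)) lTw]
end

section
/- Let τ : Fin m → Ω be a route for crane k, and suppose the consecutive positions a, a+1, …, b (with a ≤ b < m) form a block of tasks all located in the same bay, i.e., l(τ u) = l(τ a) for every u with a ≤ u ≤ b. Let τ' : Fin m → Ω be a route obtained from τ by permuting the tasks within the block (τ' u = τ u for u < a and for u > b, and { τ' u : a ≤ u ≤ b } = { τ u : a ≤ u ≤ b }). Let D and D' be the tight completion times along τ and τ' respectively, defined by the route recurrences taken with equality. Then D'(τ' u) = D(τ u) for every position u with b ≤ u < m; in particular, the completion time of the last task of the block, the completion times at all subsequent route positions, and the crane completion time C = D(τ (m−1)) + t·|l(τ (m−1)) − lT(k)| are unchanged. Consequently, any two routings that differ only by a permutation of a consecutive same-bay block on one crane produce schedules with the same makespan, which justifies strengthening the no-good cut Σ_{x ∈ C} x ≤ |C| − 1 by replacing the block's arc variables with x^k(p, S) + x^k(S) + x^k(S, q). -/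
/-- Two routes visiting the same bays in the same order have completion times that differ, at each
position, only by the difference of the total processing times up to that position. -/
lemma completion_sub_completion_eq_sum {Ω : Type*} (l : Ω → ℤ) (p : Ω → ℝ) (t rk : ℝ) (l0 : ℤ)
    {m : ℕ} (τ τ' : Fin m → Ω) (hl : ∀ i, l (τ' i) = l (τ i)) (D D' : Ω → ℝ) (hm : 0 < m)
    (hfirst : D (τ ⟨0, hm⟩) = rk + t * |(l0 : ℝ) - (l (τ ⟨0, hm⟩) : ℝ)| + p (τ ⟨0, hm⟩))
    (hstep : ∀ s : ℕ, (h : s + 1 < m) →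
      D (τ ⟨s + 1, h⟩) = D (τ ⟨s, by omega⟩) +
        t * |(l (τ ⟨s, by omega⟩) : ℝ) - (l (τ ⟨s + 1, h⟩) : ℝ)| + p (τ ⟨s + 1, h⟩))
    (hfirst' : D' (τ' ⟨0, hm⟩) = rk + t * |(l0 : ℝ) - (l (τ' ⟨0, hm⟩) : ℝ)| + p (τ' ⟨0, hm⟩))
    (hstep' : ∀ s : ℕ, (h : s + 1 < m) →
      D' (τ' ⟨s + 1, h⟩) = D' (τ' ⟨s, by omega⟩) +
        t * |(l (τ' ⟨s, by omega⟩) : ℝ) - (l (τ' ⟨s + 1, h⟩) : ℝ)| + p (τ' ⟨s + 1, h⟩))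
    (u : ℕ) (hu : u < m) :
    D' (τ' ⟨u, hu⟩) - D (τ ⟨u, hu⟩) =
      ∑ i ∈ Finset.Iic (⟨u, hu⟩ : Fin m), (p (τ' i) - p (τ i)) := by
  induction u with
  | zero =>
    have hIic : Finset.Iic (⟨0, hu⟩ : Fin m) = {⟨0, hu⟩} := by
      ext i
      simp [Fin.le_def, Fin.ext_iff]
    rw [hIic, Finset.sum_singleton, hfirst, hfirst', hl]
    ring
  | succ s ih =>
    have hIic : Finset.Iic (⟨s + 1, hu⟩ : Fin m) =
        insert ⟨s + 1, hu⟩ (Finset.Iic (⟨s, by omega⟩ : Fin m)) := by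
      ext i
      simp only [Finset.mem_Iic, Finset.mem_insert, Fin.le_def, Fin.ext_iff]
      omega
    rw [hIic, Finset.sum_insert (by simp [Fin.le_def]), ← ih (by omega), hstep s hu,
      hstep' s hu, hl, hl]
    ring

/-- Permuting a consecutive same-bay block does not change the schedule. Let
`τ` be a route for a crane and let positions `a, …, b` form a block of tasks
all located in the same bay. Let `τ'` be obtained from `τ` by permuting the
tasks within the block (identical outside it). If `D` and `D'` are the tight
completion times along `τ` and `τ'`, then `D' (τ' u) = D (τ u)` for every
position `u` with `b ≤ u < m`; in particular the crane completion time
`D (τ (m−1)) + t·|l (τ (m−1)) − lT|` is unchanged. -/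
theorem same_bay_block_permutation {Ω : Type*} [DecidableEq Ω]
    (l : Ω → ℤ) (p : Ω → ℝ) (hp : ∀ x, 0 ≤ p x) (t : ℝ) (ht : 0 ≤ t)
    (rk : ℝ) (hrk : 0 ≤ rk) (l0 lT : ℤ)
    (m : ℕ) (τ τ' : Fin m → Ω)
    (hτ : Function.Injective τ) (hτ' : Function.Injective τ')
    (a b : ℕ) (hab : a ≤ b) (hb : b < m)
    -- the block a, …, b consists of tasks all located in the same bay
    (hblock : ∀ u : ℕ, (h : u < m) → a ≤ u → u ≤ b →
      l (τ ⟨u, h⟩) = l (τ ⟨a, by omega⟩))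
    -- τ' agrees with τ outside the block
    (houtside : ∀ u : Fin m, ((u : ℕ) < a ∨ b < (u : ℕ)) → τ' u = τ u)
    -- τ' performs the same set of tasks within the block
    (hperm : (Finset.univ.filter (fun u : Fin m => a ≤ (u : ℕ) ∧ (u : ℕ) ≤ b)).image τ'
      = (Finset.univ.filter (fun u : Fin m => a ≤ (u : ℕ) ∧ (u : ℕ) ≤ b)).image τ)
    (D D' : Ω → ℝ)
    -- D is tight along τ
    (hfirst : D (τ ⟨0, by omega⟩) =
      rk + t * |((l0 : ℝ)) - (l (τ ⟨0, by omega⟩) : ℝ)| + p (τ ⟨0, by omega⟩))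
    (hstep : ∀ s : ℕ, (h : s + 1 < m) →
      D (τ ⟨s + 1, h⟩) = D (τ ⟨s, by omega⟩) +
        t * |(l (τ ⟨s, by omega⟩) : ℝ) - (l (τ ⟨s + 1, h⟩) : ℝ)| +
        p (τ ⟨s + 1, h⟩))
    -- D' is tight along τ'
    (hfirst' : D' (τ' ⟨0, by omega⟩) =
      rk + t * |((l0 : ℝ)) - (l (τ' ⟨0, by omega⟩) : ℝ)| + p (τ' ⟨0, by omega⟩))
    (hstep' : ∀ s : ℕ, (h : s + 1 < m) →
      D' (τ' ⟨s + 1, h⟩) = D' (τ' ⟨s, by omega⟩) +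
        t * |(l (τ' ⟨s, by omega⟩) : ℝ) - (l (τ' ⟨s + 1, h⟩) : ℝ)| +
        p (τ' ⟨s + 1, h⟩)) :
    (∀ u : ℕ, (h : u < m) → b ≤ u → D' (τ' ⟨u, h⟩) = D (τ ⟨u, h⟩)) ∧
    D' (τ' ⟨m - 1, by omega⟩) + t * |(l (τ' ⟨m - 1, by omega⟩) : ℝ) - (lT : ℝ)|
      = D (τ ⟨m - 1, by omega⟩) + t * |(l (τ ⟨m - 1, by omega⟩) : ℝ) - (lT : ℝ)| := by
  have hl : ∀ i, l (τ' i) = l (τ i) := by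
    intro i
    by_cases hi : a ≤ (i : ℕ) ∧ (i : ℕ) ≤ b
    · have hmem : τ' i ∈ (Finset.univ.filter
          (fun u : Fin m => a ≤ (u : ℕ) ∧ (u : ℕ) ≤ b)).image τ := by
        rw [← hperm]
        exact Finset.mem_image_of_mem _ (by simpa using hi)
      obtain ⟨j, hj, hji⟩ := Finset.mem_image.1 hmem
      obtain ⟨haj, hjb⟩ : a ≤ (j : ℕ) ∧ (j : ℕ) ≤ b := by simpa using hj
      rw [← hji]
      exact (hblock j j.2 haj hjb).trans (hblock i i.2 hi.1 hi.2).symm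
    · rw [houtside i (by omega)]
  have hsum : ∑ i ∈ Finset.univ.filter (fun u : Fin m => a ≤ (u : ℕ) ∧ (u : ℕ) ≤ b),
      (p (τ' i) - p (τ i)) = 0 := by
    rw [Finset.sum_sub_distrib, ← Finset.sum_image (f := p) hτ'.injOn, hperm,
      Finset.sum_image hτ.injOn, sub_self]
  have key : ∀ u : ℕ, (h : u < m) → b ≤ u → D' (τ' ⟨u, h⟩) = D (τ ⟨u, h⟩) := by
    intro u hu hbu
    rw [← sub_eq_zero, completion_sub_completion_eq_sum l p t rk l0 τ τ' hl D D' (by omega)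
      hfirst hstep hfirst' hstep' u hu, ← hsum]
    symm
    apply Finset.sum_subset
    · intro i hi
      simp only [Finset.mem_filter, Finset.mem_univ, true_and] at hi
      exact Finset.mem_Iic.2 (Fin.le_def.2 (hi.2.trans hbu))
    · intro i _ hi
      simp only [Finset.mem_filter, Finset.mem_univ, true_and] at hi
      rw [houtside i (by omega), sub_self]
  refine ⟨key, ?_⟩
  rw [key (m - 1) (by omega) (by omega), hl]
end
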